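/- Let w ∈ ℂ and let α, β be positive reals with αβ = 1. Then √α·(e^{−w²/8}/(2α) − e^{w²/8} ∑_{n=1}^∞ e^{−πα²n²} cos(√π·αnw)) = √β·(e^{w²/8}/(2β) − e^{−w²/8} ∑_{n=1}^∞ e^{−πβ²n²} cosh(√π·βnw)) = (1/π) ∫_0^∞ (Ξ(t/2)/(1+t²))·∇(α, w, (1+it)/2) dt. -/

import Mathlib

noncomputable section
open Complex MeasureTheory Set Filter Topology

/-- Pochhammer symbol `(a)_n`. -/
def poch (a : ℂ) (n : ℕ) : ℂ := (ascPochhammer ℂ n).eval a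

/-- Confluent hypergeometric function `₁F₁(a; c; z)`. -/
def oneF1 (a c z : ℂ) : ℂ := ∑' n : ℕ, poch a n / poch c n * z ^ n / (n.factorial : ℂ)



/-- The Riemann xi function. -/
def RiemannXi (s : ℂ) : ℂ :=
  (1/2) * s * (s - 1) * (Real.pi : ℂ) ^ (-s / 2) * Complex.Gamma (s / 2) * riemannZeta s

/-- The Riemann Xi function `Ξ(t) = ξ(1/2 + it)`. -/
def RiemannBigXi (t : ℂ) : ℂ := RiemannXi (1 / 2 + I * t)

/-- `ρ(x, w, s) = x^{1/2-s} e^{-w²/8} ₁F₁((1-s)/2; 1/2; w²/4)`. -/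
def rhoFun (x : ℝ) (w s : ℂ) : ℂ :=
  (x:ℂ) ^ ((1:ℂ)/2 - s) * Complex.exp (-w ^ 2 / 8) * oneF1 ((1 - s) / 2) (1/2) (w ^ 2 / 4)

/-- `∇(x, w, s) = ρ(x, w, s) + ρ(x, w, 1-s)`. -/
def nablaFun (x : ℝ) (w s : ℂ) : ℂ := rhoFun x w s + rhoFun x w (1 - s)

open scoped FourierTransform

def TH (w z : ℂ) : ℂ :=
  jacobiTheta₂ (-I * z * w / (2 * (Real.sqrt Real.pi : ℂ))) (I * z ^ 2)

lemma sqrtpi_sq : (Real.sqrt Real.pi : ℂ) ^ 2 = Real.pi := by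
  rw [← ofReal_pow, Real.sq_sqrt Real.pi_pos.le]

lemma sqrtpi_ne : (Real.sqrt Real.pi : ℂ) ≠ 0 := by
  rw [ofReal_ne_zero]; exact (Real.sqrt_pos.2 Real.pi_pos).ne'

lemma TH_term (w z : ℂ) (n : ℤ) :
    jacobiTheta₂_term n (-I * z * w / (2 * (Real.sqrt Real.pi : ℂ))) (I * z ^ 2)
     = Complex.exp (-Real.pi * z ^ 2 * (n:ℂ) ^ 2) *
        Complex.exp ((Real.sqrt Real.pi : ℂ) * z * n * w) := by
  rw [jacobiTheta₂_term, ← Complex.exp_add]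
  congr 1
  have h := sqrtpi_ne
  have h2 := sqrtpi_sq
  field_simp
  rw [← h2]
  linear_combination ((Real.sqrt Real.pi : ℂ)^2*n*z*(- w + √Real.pi * z * n)) * I_sq

def cterm (w z : ℂ) (n : ℕ) : ℂ :=
  Complex.exp (-Real.pi * z ^ 2 * ((n:ℂ) + 1) ^ 2) *
        Complex.cosh ((Real.sqrt Real.pi : ℂ) * z * ((n:ℂ) + 1) * w)

lemma TH_hasSum (w z : ℂ) (hz : 0 < (z ^ 2).re) :
    HasSum (fun n => 2 * cterm w z n) (TH w z - 1) := by
  have h := (hasSum_jacobiTheta₂_term (-I * z * w / (2 * (Real.sqrt Real.pi : ℂ)))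
    (τ := I * z ^ 2) (by simpa using hz))
  have h2 := h.nat_add_neg
  have h3 := (hasSum_nat_add_iff' 1).2 h2
  simp only [TH_term] at h3
  convert! h3 using 1
  · ext n
    rw [cterm, Complex.cosh]
    push_cast
    rw [neg_sq, ← mul_add]
    have : (Real.sqrt Real.pi : ℂ) * z * -((n:ℂ)+1) * w = - ((Real.sqrt Real.pi : ℂ) * z * ((n:ℂ)+1) * w) := by ring
    rw [this]
    ring
  · simp [TH]

lemma TH_feq (w : ℂ) (x : ℝ) (hx : 0 < x) :
    TH w ((1 / x : ℝ) : ℂ) = x * Complex.exp (w ^ 2 / 4) * TH (-I * w) x := by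
  have hx' : (x:ℂ) ≠ 0 := by exact_mod_cast hx.ne'
  have hp := sqrtpi_ne
  rw [TH, jacobiTheta₂_functional_equation, TH]
  have e1 : -I * (I * ((1 / x : ℝ) : ℂ) ^ 2) = (((1/x)^2 : ℝ) : ℂ) := by
    push_cast; linear_combination (-(1/(x:ℂ))^2) * I_sq
  have e2 : (1 / (-I * (I * ((1 / x : ℝ) : ℂ) ^ 2)) ^ (1 / 2 : ℂ)) = x := by
    rw [e1]
    have : (1 / 2 : ℂ) = ((1/2 : ℝ) : ℂ) := by push_cast; rfl
    rw [this, ← ofReal_cpow (by positivity), ← Real.sqrt_eq_rpow, Real.sqrt_sq (by positivity)]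
    push_cast; field_simp
  rw [e2]
  congr 2
  · congr 1
    rw [← sqrtpi_sq]
    push_cast
    have := I_ne_zero
    field_simp
    linear_combination (-4 * w^2) * I_sq
  · have := I_ne_zero
    push_cast
    field_simp
    linear_combination (-w) * I_sq
  · have := I_ne_zero
    push_cast
    field_simp
    linear_combination (-1) * I_sq

lemma cosh_norm_le (z : ℂ) : ‖Complex.cosh z‖ ≤ Real.exp ‖z‖ := by
  rw [Complex.cosh, norm_div]
  have h1 := Complex.norm_exp_le_exp_norm z
  have h2 := Complex.norm_exp_le_exp_norm (-z)
  rw [norm_neg] at h2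
  have := norm_add_le (Complex.exp z) (Complex.exp (-z))
  simp only [Complex.norm_ofNat]
  linarith

lemma cterm_bound (w z : ℂ) (hz : 2 * ‖z‖ ^ 2 ≤ 3 * (z ^ 2).re) (n : ℕ) :
    ‖cterm w z n‖ ≤ Real.exp (Real.pi * ‖w‖ ^ 2 / 4) * Real.exp (-(((n:ℝ) + 1) * ‖z‖) ^ 2) := by
  rw [cterm, norm_mul, Complex.norm_exp, ← Real.exp_add]
  have e : (-Real.pi * z ^ 2 * ((n:ℂ) + 1) ^ 2).re = -Real.pi * ((n:ℝ)+1)^2 * (z^2).re := by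
    have : (-Real.pi * z ^ 2 * ((n:ℂ) + 1) ^ 2) = ((-Real.pi * ((n:ℝ)+1)^2 : ℝ) : ℂ) * z^2 := by
      push_cast; ring
    rw [this, re_ofReal_mul]
  have e2 : ‖(Real.sqrt Real.pi : ℂ) * z * ((n:ℂ) + 1) * w‖ = Real.sqrt Real.pi * ‖z‖ * (n+1) * ‖w‖ := by
    have : ((n:ℂ)+1) = ((n+1 : ℝ) : ℂ) := by push_cast; rfl
    rw [this, norm_mul, norm_mul, norm_mul, norm_real, norm_real, Real.norm_of_nonneg (by positivity), Real.norm_of_nonneg (by positivity)]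
  have h2 := cosh_norm_le ((Real.sqrt Real.pi : ℂ) * z * ((n:ℂ) + 1) * w)
  rw [e2] at h2
  rw [e]
  refine (mul_le_mul_of_nonneg_left h2 (Real.exp_pos _).le).trans ?_
  rw [← Real.exp_add, Real.exp_le_exp]
  set q := ((n:ℝ)+1)*‖z‖
  have hs := Real.sq_sqrt Real.pi_pos.le
  have h3 : Real.pi * ((n:ℝ)+1)^2 * (z^2).re ≥ 2 * q^2 := by
    have : ((n:ℝ)+1)^2 * (z^2).re * 3 ≥ 2 * q^2 := by
      have := mul_le_mul_of_nonneg_left hz (sq_nonneg ((n:ℝ)+1))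
      simp only [q]; nlinarith
    nlinarith [Real.pi_gt_three, sq_nonneg q]
  have h4 : Real.sqrt Real.pi * ‖z‖ * (n+1) * ‖w‖ = Real.sqrt Real.pi * ‖w‖ * q := by simp only [q]; ring
  rw [h4]
  nlinarith [sq_nonneg (q - Real.sqrt Real.pi * ‖w‖ / 2)]

def Bw (w : ℂ) : ℝ := 4 * Real.exp (Real.pi * ‖w‖ ^ 2 / 4) * ∑' n : ℕ, 1 / ((n:ℝ) + 1) ^ 2

lemma summ_sq : Summable (fun n : ℕ => 1 / ((n:ℝ) + 1) ^ 2) := by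
  have := (summable_nat_add_iff 1).2 (Real.summable_one_div_nat_pow.2 (one_lt_two))
  simpa using this

lemma Bw_nonneg (w : ℂ) : 0 ≤ Bw w := by
  have : 0 ≤ ∑' n : ℕ, 1 / ((n:ℝ) + 1) ^ 2 := tsum_nonneg (fun n => by positivity)
  unfold Bw; positivity

lemma TH_bound (w z : ℂ) (h0 : z ≠ 0) (hz : 2 * ‖z‖ ^ 2 ≤ 3 * (z ^ 2).re) :
    ‖TH w z - 1‖ ≤ Bw w * Real.exp (-‖z‖ ^ 2 / 2) / ‖z‖ ^ 2 := by
  have hr : 0 < ‖z‖ := norm_pos_iff.2 h0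
  have hz' : 0 < (z^2).re := by nlinarith [pow_pos hr 2]
  rw [← (TH_hasSum w z hz').tsum_eq]
  have hb : ∀ n, ‖2 * cterm w z n‖ ≤ (4 * Real.exp (Real.pi * ‖w‖ ^ 2 / 4) *
      (Real.exp (-‖z‖ ^ 2 / 2) / ‖z‖ ^ 2)) * (1 / ((n:ℝ) + 1) ^ 2) := by
    intro n
    rw [norm_mul, Complex.norm_ofNat]
    have h1 := cterm_bound w z hz n
    have h2 : Real.exp (-(((n:ℝ) + 1) * ‖z‖) ^ 2) ≤ Real.exp (-‖z‖^2/2) * (2 / (((n:ℝ)+1)^2 * ‖z‖^2)) := by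
      set q := (((n:ℝ) + 1) * ‖z‖) ^ 2 with hq
      have hqe : ((n:ℝ)+1)^2 * ‖z‖^2 = q := by rw [hq]; ring
      rw [hqe]
      have hq0 : 0 < q := by positivity
      have hqz : ‖z‖^2 ≤ q := by
        rw [← hqe]
        have : (1:ℝ) ≤ ((n:ℝ)+1)^2 := by nlinarith [(Nat.cast_nonneg n : (0:ℝ) ≤ n)]
        nlinarith [pow_pos hr 2]
      have : Real.exp (-q) = Real.exp (-q/2) * Real.exp (-q/2) := by rw [← Real.exp_add]; ring_nf
      rw [this]
      refine mul_le_mul (Real.exp_le_exp.2 (by linarith)) ?_ (Real.exp_pos _).le (Real.exp_pos _).le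
      rw [neg_div, Real.exp_neg, inv_le_comm₀ (Real.exp_pos _) (by positivity)]
      have := Real.add_one_le_exp (q/2)
      rw [inv_div]; linarith
    have h3 := mul_le_mul_of_nonneg_left h2 (Real.exp_pos (Real.pi * ‖w‖ ^ 2 / 4)).le
    refine (mul_le_mul_of_nonneg_left (h1.trans h3) zero_le_two).trans (le_of_eq ?_)
    field_simp
    ring
  refine (tsum_of_norm_bounded (summ_sq.mul_left _).hasSum hb).trans (le_of_eq ?_)
  rw [tsum_mul_left, Bw]; ring

lemma TH_differentiableAt (w z : ℂ) (hz : 0 < (z ^ 2).re) : DifferentiableAt ℂ (TH w) z := by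
  have h := (hasFDerivAt_jacobiTheta₂ (-I * z * w / (2 * (Real.sqrt Real.pi : ℂ)))
    (τ := I * z ^ 2) (by simpa using hz)).differentiableAt
  have h2 : DifferentiableAt ℂ (fun z : ℂ => ((-I * z * w / (2 * (Real.sqrt Real.pi : ℂ)), I * z ^ 2) : ℂ × ℂ)) z := by
    fun_prop
  exact DifferentiableAt.comp (g := fun p : ℂ × ℂ ↦ jacobiTheta₂ p.1 p.2) z h h2

lemma TH_tsum (w z : ℂ) (hz : 0 < (z ^ 2).re) :
    ∑' n : ℕ+, Complex.exp (-Real.pi * z ^ 2 * (n:ℂ) ^ 2) *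
                Complex.cosh ((Real.sqrt Real.pi : ℂ) * z * n * w) = (TH w z - 1) / 2 := by
  have := (TH_hasSum w z hz).tsum_eq
  rw [tsum_mul_left] at this
  rw [← this, mul_div_cancel_left₀ _ two_ne_zero]
  rw [tsum_pnat_eq_tsum_succ (f := fun n : ℕ => Complex.exp (-Real.pi * z ^ 2 * (n:ℂ) ^ 2) *
                Complex.cosh ((Real.sqrt Real.pi : ℂ) * z * n * w))]
  simp [cterm]

def HH (w u : ℂ) : ℂ :=
  Complex.exp (u / 2) * (TH w (Complex.exp u) - 1) - Complex.exp (w ^ 2 / 4) * Complex.exp (-u / 2)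

def strip : Set ℂ := {u | |u.im| < 3/8}

lemma strip_open : IsOpen strip :=
  isOpen_lt (by fun_prop) (by fun_prop)

lemma exp_sector (u : ℂ) (hu : |u.im| < 3/8) :
    2 * ‖Complex.exp u‖ ^ 2 ≤ 3 * ((Complex.exp u) ^ 2).re ∧ 0 < ((Complex.exp u) ^ 2).re := by
  have h1 : ((Complex.exp u) ^ 2).re = ‖Complex.exp u‖ ^ 2 * Real.cos (2 * u.im) := by
    rw [← Complex.exp_nat_mul, Complex.exp_re, Complex.norm_exp, ← Real.exp_nat_mul]
    simp
  have h2 := Real.one_sub_sq_div_two_le_cos (x := 2 * u.im)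
  have h3 := abs_lt.1 hu
  have h4 : 2 / 3 < Real.cos (2 * u.im) := by nlinarith
  have h5 : 0 < ‖Complex.exp u‖ ^ 2 := by have := Complex.exp_ne_zero u; positivity
  rw [h1]
  constructor <;> nlinarith

lemma HH_diff (w : ℂ) : DifferentiableOn ℂ (HH w) strip := by
  intro u hu
  apply DifferentiableAt.differentiableWithinAt
  have h := TH_differentiableAt w (Complex.exp u) (exp_sector u hu).2
  have h2 : DifferentiableAt ℂ (fun u => TH w (Complex.exp u)) u :=
    DifferentiableAt.comp (g := TH w) u h (Complex.differentiable_exp u)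
  unfold HH
  fun_prop

def Mw (w : ℂ) : ℝ := (Bw w * Real.exp (1/4) + ‖Complex.exp (w ^ 2 / 4)‖) * Real.exp (1/8)

lemma HH_bound (w u : ℂ) (u0 : ℝ) (h0 : 0 ≤ u0) (hu : ‖u - u0‖ ≤ 1/4) :
    ‖HH w u‖ ≤ Mw w * Real.exp (-u0/2) := by
  have him : |u.im| ≤ 1/4 := by
    have := (abs_im_le_norm (u - u0)).trans hu
    simpa using this
  have hre : |u.re - u0| ≤ 1/4 := by
    have := (abs_re_le_norm (u - u0)).trans hu
    simpa using this
  have hre' := (abs_le.1 hre).1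
  have hs := (exp_sector u (by linarith)).1
  have hT := TH_bound w (Complex.exp u) (Complex.exp_ne_zero u) hs
  have hT2 : ‖TH w (Complex.exp u) - 1‖ ≤ Bw w * Real.exp (-2 * u.re) := by
    refine hT.trans ?_
    rw [mul_div_assoc]
    refine mul_le_mul_of_nonneg_left ?_ (Bw_nonneg w)
    rw [Complex.norm_exp, ← Real.exp_nat_mul, div_le_iff₀ (Real.exp_pos _), ← Real.exp_add]
    apply Real.exp_le_exp.2
    push_cast
    have := Real.exp_pos (2 * u.re)
    linarith
  unfold HH
  refine (norm_sub_le _ _).trans ?_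
  rw [norm_mul, norm_mul, Complex.norm_exp (u/2), Complex.norm_exp (-u/2)]
  have e1 : (u/2).re = u.re/2 := by simp
  have e2 : (-u/2).re = -u.re/2 := by simp
  rw [e1, e2, Mw, add_mul, add_mul]
  apply add_le_add
  · refine (mul_le_mul_of_nonneg_left hT2 (Real.exp_pos _).le).trans ?_
    rw [mul_left_comm, mul_assoc, mul_assoc, ← Real.exp_add, ← Real.exp_add, ← Real.exp_add]
    refine mul_le_mul_of_nonneg_left (Real.exp_le_exp.2 ?_) (Bw_nonneg w)
    linarith
  · rw [mul_assoc, ← Real.exp_add]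
    refine mul_le_mul_of_nonneg_left (Real.exp_le_exp.2 ?_) (norm_nonneg _)
    linarith

lemma real_mem_strip (u : ℝ) : (u : ℂ) ∈ strip := by simp [strip]

lemma HH_iter_bound (w : ℂ) (n : ℕ) (u0 : ℝ) (h0 : 0 ≤ u0) :
    ‖iteratedDeriv n (HH w) u0‖ ≤ n.factorial * (Mw w * Real.exp (-u0/2)) / (1/4) ^ n := by
  refine norm_iteratedDeriv_le_of_forall_mem_sphere_norm_le n (by norm_num) ?_ ?_
  · apply DifferentiableOn.diffContOnCl
    apply (HH_diff w).mono
    intro z hz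
    have := Metric.closure_ball_subset_closedBall hz
    rw [mem_closedBall_iff_norm] at this
    have h2 := (abs_im_le_norm (z - u0)).trans this
    simp at h2
    simp only [strip, mem_ofPred_eq]
    norm_num at *
    linarith
  · intro z hz
    apply HH_bound w z u0 h0
    rw [mem_sphere_iff_norm] at hz
    exact hz.le

def hr (w : ℂ) (u : ℝ) : ℂ := HH w u

lemma HH_an (w : ℂ) (u : ℝ) : AnalyticAt ℂ (HH w) u :=
  (HH_diff w).analyticAt (strip_open.mem_nhds (real_mem_strip u))

lemma hr_iter (w : ℂ) (n : ℕ) : iteratedDeriv n (hr w) = fun u : ℝ => iteratedDeriv n (HH w) u := by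
  induction n with
  | zero => simp; rfl
  | succ n ih =>
    rw [iteratedDeriv_succ, ih, iteratedDeriv_succ]
    ext u
    have : DifferentiableAt ℂ (iteratedDeriv n (HH w)) u := by
      rw [iteratedDeriv_eq_iterate]
      exact ((HH_an w u).iterated_deriv n).differentiableAt
    exact this.hasDerivAt.comp_ofReal.deriv

lemma hr_contDiff (w : ℂ) (n : ℕ∞) : ContDiff ℝ n (hr w) := by
  rw [contDiff_iff_contDiffAt]
  intro u
  have h1 : ContDiffAt ℝ n (HH w) u := ((HH_an w u).contDiffAt).restrict_scalars ℝ
  have h2 : ContDiffAt ℝ n (fun u : ℝ => (u : ℂ)) u := ofRealCLM.contDiff.contDiffAt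
  exact ContDiffAt.comp (g := HH w) u h1 h2

lemma hr_symm (w : ℂ) (u : ℝ) : hr w (-u) = Complex.exp (w ^ 2 / 4) * hr (-I * w) u := by
  unfold hr HH
  have h := TH_feq w (Real.exp u) (Real.exp_pos u)
  have e : Complex.exp ((-u : ℝ) : ℂ) = ((1 / Real.exp u : ℝ) : ℂ) := by
    rw [← ofReal_exp, Real.exp_neg]; simp
  have e2 : (-I * w) ^ 2 / 4 = -(w^2/4) := by rw [mul_pow, neg_sq, I_sq]; ring
  rw [e, h, ofReal_exp, e2]
  have e3 : Complex.exp (u:ℂ) = Complex.exp (u/2) * Complex.exp (u/2) := by rw [← Complex.exp_add]; ring_nf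
  have e4 : Complex.exp ((-u:ℝ)/2:ℂ) = (Complex.exp ((u:ℂ)/2))⁻¹ := by rw [← Complex.exp_neg]; push_cast; ring_nf
  have e5 : Complex.exp (-(u:ℂ)/2) = (Complex.exp ((u:ℂ)/2))⁻¹ := by rw [← Complex.exp_neg]; ring_nf
  have e6 : Complex.exp (-((-u:ℝ):ℂ)/2) = (Complex.exp ((u:ℂ)/2)) := by push_cast; ring_nf
  rw [e4, e5, e6, Complex.exp_neg]
  generalize TH (-I * w) (Complex.exp u) = A
  rw [e3]
  have := Complex.exp_ne_zero (u/2)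
  have := Complex.exp_ne_zero (w^2/4)
  field_simp
  ring

lemma exp_le_inv (u : ℝ) (hu : 0 ≤ u) : Real.exp (-u/2) ≤ 8 * (1 + u ^ 2)⁻¹ := by
  have h := Real.quadratic_le_exp_of_nonneg (x := u/2) (by linarith)
  rw [neg_div, Real.exp_neg, ← div_eq_mul_inv, inv_le_comm₀ (Real.exp_pos _) (by positivity), inv_div]
  nlinarith

lemma hr_iter_bound_pos (w : ℂ) (n : ℕ) (u : ℝ) (hu : 0 ≤ u) :
   ‖iteratedDeriv n (hr w) u‖ ≤ (n.factorial * Mw w / (1/4) ^ n * 8) * (1 + u ^ 2)⁻¹ := by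
  rw [hr_iter]
  refine (HH_iter_bound w n u hu).trans ?_
  have hM : 0 ≤ Mw w := by have := Bw_nonneg w; unfold Mw; positivity
  have := mul_le_mul_of_nonneg_left (exp_le_inv u hu) (show 0 ≤ n.factorial * Mw w / (1/4) ^ n by positivity)
  calc _ = n.factorial * Mw w / (1/4) ^ n * Real.exp (-u/2) := by ring
    _ ≤ _ := this
    _ = _ := by ring

lemma hr_iter_bound (w : ℂ) (n : ℕ) : ∃ C : ℝ, ∀ u : ℝ,
   ‖iteratedDeriv n (hr w) u‖ ≤ C * (1 + u ^ 2)⁻¹ := by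
  have h1 := hr_iter_bound_pos w n
  have h2 := hr_iter_bound_pos (-I * w) n
  set C1 := (n.factorial * Mw w / (1/4) ^ n * 8)
  set C2 := (n.factorial * Mw (-I * w) / (1/4) ^ n * 8)
  set E := ‖Complex.exp (w^2/4)‖
  have hfun : hr w = fun u => (fun v => Complex.exp (w^2/4) * hr (-I * w) v) (-u) := by
    ext u
    have := hr_symm w (-u)
    simpa using this
  refine ⟨max C1 (E * C2), fun u => ?_⟩
  rcases le_total 0 u with hu | hu
  · refine (h1 u hu).trans ?_
    gcongr
    exact le_max_left _ _
  · rw [hfun, iteratedDeriv_comp_neg n (fun v => Complex.exp (w^2/4) * hr (-I * w) v) u, norm_smul, norm_pow, norm_neg, norm_one, one_pow, one_mul,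
      iteratedDeriv_const_mul _ ((hr_contDiff _ n).contDiffAt), norm_mul]
    have := h2 (-u) (by linarith)
    rw [neg_sq] at this
    refine (mul_le_mul_of_nonneg_left this (norm_nonneg _)).trans ?_
    rw [← mul_assoc]
    gcongr
    exact le_max_right _ _

lemma hr_iter_int (w : ℂ) (n : ℕ) : Integrable (iteratedDeriv n (hr w)) := by
  obtain ⟨C, hC⟩ := hr_iter_bound w n
  refine (integrable_inv_one_add_sq.const_mul C).mono' ?_ (Eventually.of_forall hC)
  exact ((hr_contDiff w n).continuous_iteratedDeriv n le_rfl).aestronglyMeasurable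

lemma hr_int (w : ℂ) : Integrable (hr w) := by
  simpa using hr_iter_int w 0

lemma fourier_bdd (f : ℝ → ℂ) (x : ℝ) : ‖𝓕 f x‖ ≤ ∫ v, ‖f v‖ := by
  exact VectorFourier.norm_fourierIntegral_le_integral_norm _ _ _ _ _

lemma hr_fourier_int (w : ℂ) : Integrable (𝓕 (hr w)) := by
  have h := Real.fourier_iteratedDeriv (N := 2) (n := 2) (hr_contDiff w 2)
    (fun n _ => hr_iter_int w n) (le_rfl)
  set A := ∫ v, ‖hr w v‖
  set B := ∫ v, ‖iteratedDeriv 2 (hr w) v‖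
  have hcont : Continuous (𝓕 (hr w)) :=
    VectorFourier.fourierIntegral_continuous Real.continuous_fourierChar (by fun_prop) (hr_int w)
  refine (integrable_inv_one_add_sq.const_mul (A + B)).mono' hcont.aestronglyMeasurable
    (Eventually.of_forall fun x => ?_)
  have h1 := fourier_bdd (hr w) x
  have h2 := fourier_bdd (iteratedDeriv 2 (hr w)) x
  rw [h] at h2
  simp only [norm_smul, norm_pow, norm_mul, norm_real, norm_I, Complex.norm_ofNat] at h2
  rw [Real.norm_of_nonneg Real.pi_pos.le, Real.norm_eq_abs, mul_one, mul_pow, sq_abs] at h2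
  rw [← div_eq_mul_inv, le_div_iff₀ (by positivity)]
  have h3 : x^2 * ‖𝓕 (hr w) x‖ ≤ (2 * Real.pi)^2 * x^2 * ‖𝓕 (hr w) x‖ := by
    have : 1 ≤ (2 * Real.pi)^2 := by nlinarith [Real.pi_gt_three]
    have h0 : 0 ≤ x^2 * ‖𝓕 (hr w) x‖ := by positivity
    nlinarith
  nlinarith

lemma poch_succ (a : ℂ) (n : ℕ) : poch a (n+1) = poch a n * (a + n) := by
  unfold poch; rw [ascPochhammer_succ_eval]

lemma poch_zero (a : ℂ) : poch a 0 = 1 := by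
  unfold poch; simp

lemma Gamma_poch (a : ℂ) (ha : 0 < a.re) (k : ℕ) :
    Complex.Gamma (a + k) = Complex.Gamma a * poch a k := by
  induction k with
  | zero => simp [poch_zero]
  | succ k ih =>
    have hne : a + k ≠ 0 := by
      intro h
      have := congrArg Complex.re h
      simp at this
      have := (Nat.cast_nonneg k : (0:ℝ) ≤ k)
      linarith
    rw [poch_succ, ← mul_assoc, ← ih]
    push_cast
    rw [← add_assoc, Complex.Gamma_add_one _ hne]; ring

lemma poch_half (k : ℕ) : ((2 * k).factorial : ℂ) = 4 ^ k * k.factorial * poch (1/2) k := by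
  induction k with
  | zero => simp [poch_zero]
  | succ k ih =>
    rw [show 2 * (k+1) = 2 * k + 1 + 1 by ring, Nat.factorial_succ, Nat.factorial_succ, poch_succ, Nat.factorial_succ]
    push_cast
    rw [ih]
    ring

lemma poch_half_ne (k : ℕ) : poch (1/2) k ≠ 0 := by
  have h := poch_half k
  intro h0
  rw [h0, mul_zero] at h
  exact (Nat.factorial_ne_zero (2*k)) (by exact_mod_cast h)

def hterm (a w : ℂ) (k : ℕ) : ℂ := poch a k * w ^ (2 * k) / ((2 * k).factorial : ℂ)

lemma oneF1_eq (a w : ℂ) : oneF1 a (1/2) (w ^ 2 / 4) = ∑' k, hterm a w k := by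
  unfold oneF1 hterm
  congr 1
  ext k
  rw [poch_half, div_pow, ← pow_mul]
  have := poch_half_ne k
  have : (k.factorial : ℂ) ≠ 0 := by exact_mod_cast k.factorial_ne_zero
  field_simp

def mj (R x : ℝ) (n : ℕ) : ℝ := (ascPochhammer ℝ n).eval R * x ^ (2 * n) / ((2 * n).factorial : ℝ)

lemma mj_succ (R x : ℝ) (n : ℕ) :
    mj R x (n+1) = mj R x n * ((R + n) * x ^ 2 / ((2 * n + 1) * (2 * n + 2))) := by
  unfold mj
  rw [show 2 * (n+1) = 2 * n + 1 + 1 by ring, Nat.factorial_succ, Nat.factorial_succ, ascPochhammer_succ_eval]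
  push_cast
  have : ((2*n).factorial : ℝ) ≠ 0 := by exact_mod_cast (2*n).factorial_ne_zero
  field_simp
  ring

lemma mj_summable (R x : ℝ) (hR : 0 ≤ R) : Summable (mj R x) := by
  apply summable_of_ratio_norm_eventually_le (r := 1/2) (by norm_num)
  filter_upwards [eventually_ge_atTop (⌈(R+1) * x^2⌉₊)] with n hn
  rw [mj_succ, norm_mul, mul_comm]
  refine mul_le_mul_of_nonneg_right ?_ (norm_nonneg _)
  have hn' : (R+1) * x^2 ≤ n := (Nat.le_ceil _).trans (by exact_mod_cast hn)
  have hn0 := (Nat.cast_nonneg n : (0:ℝ) ≤ n)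
  rw [Real.norm_of_nonneg (by positivity), div_le_iff₀ (by positivity)]
  have : (R + n) * x^2 ≤ (n + 1) * ((R+1) * x^2) := by
    have : R + n ≤ (n+1) * (R+1) := by nlinarith
    nlinarith [mul_le_mul_of_nonneg_right this (sq_nonneg x)]
  nlinarith

lemma poch_norm_le (a : ℂ) (R : ℝ) (hR : ‖a‖ ≤ R) (n : ℕ) :
    ‖poch a n‖ ≤ (ascPochhammer ℝ n).eval R ∧ 0 ≤ (ascPochhammer ℝ n).eval R := by
  have hR0 := (norm_nonneg a).trans hR
  induction n with
  | zero => simp [poch_zero]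
  | succ n ih =>
    rw [poch_succ, ascPochhammer_succ_eval, norm_mul]
    have h1 : ‖a + n‖ ≤ R + n := by
      refine (norm_add_le _ _).trans ?_
      simp [hR]
    exact ⟨mul_le_mul ih.1 h1 (norm_nonneg _) ih.2, mul_nonneg ih.2 (by positivity)⟩

lemma hterm_bound (a w : ℂ) (R : ℝ) (hR : ‖a‖ ≤ R) (n : ℕ) : ‖hterm a w n‖ ≤ mj R ‖w‖ n := by
  unfold hterm mj
  rw [norm_div, norm_mul, norm_pow, Complex.norm_natCast]
  gcongr
  exact (poch_norm_le a R hR n).1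

lemma hterm_summable (a w : ℂ) : Summable (hterm a w) :=
  (mj_summable ‖a‖ ‖w‖ (norm_nonneg a)).of_norm_bounded (hterm_bound a w ‖a‖ le_rfl)

lemma oneF1_diff (w : ℂ) : Differentiable ℂ (fun s : ℂ => oneF1 (s/2) (1/2) (w^2/4)) := by
  simp_rw [oneF1_eq]
  have key : Differentiable ℂ (fun a : ℂ => ∑' k, hterm a w k) := by
    intro a
    have : DifferentiableOn ℂ (fun a : ℂ => ∑' k, hterm a w k) (Metric.ball 0 (‖a‖ + 1)) := by
      apply Complex.differentiableOn_tsum_of_summable_norm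
        (mj_summable (‖a‖+1) ‖w‖ (by positivity)) _ Metric.isOpen_ball
      · intro k z hz
        exact hterm_bound z w _ (by simpa using (mem_ball_zero_iff.1 hz).le) k
      · intro k
        unfold hterm poch
        apply Differentiable.differentiableOn
        have := (ascPochhammer ℂ k).differentiable
        fun_prop
    exact this.differentiableAt (Metric.isOpen_ball.mem_nhds (by simp))
  exact key.comp (differentiable_id.div_const 2)

lemma mellin_gauss (s : ℂ) (hs : 0 < s.re) :
    ∫ x in Ioi (0:ℝ), (x:ℂ) ^ (s - 1) * Complex.exp (-Real.pi * (x:ℂ) ^ 2)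
      = 1/2 * ((Real.pi : ℂ) ^ (-s/2) * Complex.Gamma (s/2)) := by
  have h1 := mellin_comp_rpow (fun t : ℝ => Complex.exp (-(Real.pi * t))) s 2
  have h2 := integral_cpow_mul_exp_neg_mul_Ioi (a := s/2) (r := Real.pi) (by simpa using hs) Real.pi_pos
  unfold mellin at h1
  simp only [smul_eq_mul] at h1
  have e : ((2:ℝ):ℂ) = 2 := by norm_num
  rw [e, h2] at h1
  simp only [Real.rpow_two, ofReal_pow, neg_mul] at h1 ⊢
  rw [h1]
  have hpi : (Real.pi : ℂ) ≠ 0 := by exact_mod_cast Real.pi_ne_zero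
  have e3 : (1 / (Real.pi:ℂ)) ^ (s/2) = (Real.pi:ℂ) ^ (-s/2) := by
    rw [one_div, inv_cpow _ _ (by rw [arg_ofReal_of_nonneg Real.pi_pos.le]; exact Real.pi_pos.ne), neg_div, cpow_neg]
  rw [e3]
  simp

def FF (s w : ℂ) (k : ℕ) (x : ℝ) : ℂ :=
  (x:ℂ) ^ (s - 1) * (Complex.exp (-Real.pi * (x:ℂ) ^ 2) *
    (((Real.sqrt Real.pi : ℂ) * x * w) ^ (2 * k) / ((2 * k).factorial : ℂ)))

lemma FF_integral (s w : ℂ) (hs : 0 < s.re) (k : ℕ) :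
    ∫ x in Ioi (0:ℝ), FF s w k x =
      1/2 * ((Real.pi : ℂ) ^ (-s/2) * Complex.Gamma (s/2)) * hterm (s/2) w k := by
  have h := mellin_gauss (s + 2 * k) (by simp; positivity)
  have hpi : (Real.pi : ℂ) ≠ 0 := by exact_mod_cast Real.pi_ne_zero
  have e : ∀ x ∈ Ioi (0:ℝ), FF s w k x = ((Real.pi : ℂ) ^ k * w ^ (2*k) / ((2 * k).factorial : ℂ)) *
      ((x:ℂ) ^ (s + 2 * k - 1) * Complex.exp (-Real.pi * (x:ℂ) ^ 2)) := by
    intro x hx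
    have hx' : (x:ℂ) ≠ 0 := by exact_mod_cast (ne_of_gt hx)
    unfold FF
    rw [show s + 2 * k - 1 = (s - 1) + ((2 * k : ℕ) : ℂ) by push_cast; ring, cpow_add _ _ hx', cpow_natCast,
      mul_pow, mul_pow, pow_mul (Real.sqrt Real.pi : ℂ), sqrtpi_sq]
    ring
  rw [setIntegral_congr_fun measurableSet_Ioi e, integral_const_mul, h,
    show -(s + 2 * k)/2 = -s/2 + -(k:ℂ) by ring, show (s + 2 * k)/2 = s/2 + k by ring, cpow_add _ _ hpi,
    Gamma_poch _ (by simpa using hs), cpow_neg, cpow_natCast, hterm]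
  have := pow_ne_zero k hpi
  field_simp

lemma gint (σ : ℝ) (hσ : 0 < σ) (b : ℝ) (hb : 0 < b) :
    IntegrableOn (fun x : ℝ => x ^ (σ - 1) * Real.exp (-b * x ^ 2)) (Ioi 0) :=
  integrableOn_rpow_mul_exp_neg_mul_sq hb (by linarith)

lemma FF_norm (s w : ℂ) (k : ℕ) (x : ℝ) (hx : 0 < x) :
    (‖FF s w k x‖ : ℂ) = FF s.re ‖w‖ k x := by
  unfold FF
  rw [norm_mul, norm_mul, norm_div, norm_pow, norm_mul, norm_mul, norm_real, norm_real, Complex.norm_natCast,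
    norm_cpow_eq_rpow_re_of_pos hx, Complex.norm_exp, Real.norm_of_nonneg hx.le, Real.norm_of_nonneg (Real.sqrt_nonneg _)]
  push_cast
  rw [ofReal_cpow hx.le]
  have e : (-Real.pi * (x:ℂ) ^ 2) = ((-Real.pi * x^2 : ℝ) : ℂ) := by push_cast; rfl
  have e2 : (-Real.pi * (x:ℂ) ^ 2).re = -Real.pi * x^2 := by rw [e, ofReal_re]
  rw [e2]
  push_cast
  simp

lemma FF_int (s w : ℂ) (hs : 0 < s.re) (k : ℕ) : IntegrableOn (FF s w k) (Ioi 0) := by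
  have h := (gint (s.re + 2 * k) (by positivity) Real.pi Real.pi_pos).const_mul
    (Real.pi ^ k * ‖w‖ ^ (2*k) / ((2 * k).factorial : ℝ))
  refine Integrable.mono' h ?_ ?_
  · apply ContinuousOn.aestronglyMeasurable _ measurableSet_Ioi
    intro x hx
    apply ContinuousAt.continuousWithinAt
    unfold FF
    have : ContinuousAt (fun x : ℝ => (x:ℂ) ^ (s-1)) x :=
      continuousAt_ofReal_cpow_const _ _ (Or.inr (ne_of_gt hx))
    fun_prop
  · filter_upwards [ae_restrict_mem measurableSet_Ioi] with x hx
    have hx : 0 < x := hx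
    unfold FF
    rw [norm_mul, norm_mul, norm_div, norm_pow, norm_mul, norm_mul, norm_real, norm_real, Complex.norm_natCast,
      norm_cpow_eq_rpow_re_of_pos hx, Complex.norm_exp, Real.norm_of_nonneg hx.le, Real.norm_of_nonneg (Real.sqrt_nonneg _)]
    have e : (-Real.pi * (x:ℂ) ^ 2) = ((-Real.pi * x^2 : ℝ) : ℂ) := by push_cast; rfl
    have e2 : (-Real.pi * (x:ℂ) ^ 2).re = -Real.pi * x^2 := by rw [e, ofReal_re]
    rw [e2, show s.re + 2 * k - 1 = (s.re - 1) + ((2 * k : ℕ) : ℝ) by push_cast; ring, Real.rpow_add hx,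
      Real.rpow_natCast, mul_pow, mul_pow, pow_mul (Real.sqrt Real.pi), Real.sq_sqrt Real.pi_pos.le]
    apply le_of_eq
    simp
    ring

def phi (w : ℂ) (x : ℝ) : ℂ :=
  Complex.exp (-Real.pi * (x:ℂ) ^ 2) * Complex.cosh ((Real.sqrt Real.pi : ℂ) * x * w)

lemma phi_mellin (s w : ℂ) (hs : 0 < s.re) :
    mellin (phi w) s = 1/2 * ((Real.pi : ℂ) ^ (-s/2) * Complex.Gamma (s/2)) *
      oneF1 (s/2) (1/2) (w^2/4) := by
  have hsum : Summable (fun k => ∫ x in Ioi (0:ℝ), ‖FF s w k x‖) := by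
    have h1 : Summable (fun k => ‖∫ x in Ioi (0:ℝ), FF s.re ‖w‖ k x‖) := by
      simp_rw [FF_integral (s.re : ℂ) ‖w‖ (by simpa using hs)]
      exact ((hterm_summable _ _).mul_left _).norm
    convert h1 using 2 with k
    rw [← setIntegral_congr_fun measurableSet_Ioi (fun x hx => FF_norm s w k x hx), integral_complex_ofReal, norm_real,
      Real.norm_of_nonneg (integral_nonneg (fun x => norm_nonneg _))]
  have h := hasSum_integral_of_summable_integral_norm (fun k => FF_int s w hs k) hsum
  simp_rw [FF_integral s w hs] at h
  rw [oneF1_eq, ← tsum_mul_left, h.tsum_eq, mellin]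
  congr 1
  ext x
  unfold FF phi
  rw [tsum_mul_left, tsum_mul_left, (Complex.hasSum_cosh _).tsum_eq, smul_eq_mul]

lemma phi_cterm (w : ℂ) (n : ℕ) (x : ℝ) : cterm w x n = phi w (((n:ℝ)+1) * x) := by
  unfold cterm phi
  push_cast
  congr 2 <;> ring

lemma phi_conv (s w : ℂ) (hs : 0 < s.re) : MellinConvergent (phi w) s := by
  have h := (gint s.re hs 1 one_pos).const_mul (Real.exp (Real.pi * ‖w‖ ^ 2 / 4))
  refine Integrable.mono' h ?_ ?_
  · apply ContinuousOn.aestronglyMeasurable _ measurableSet_Ioi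
    intro x hx
    apply ContinuousAt.continuousWithinAt
    unfold phi
    have : ContinuousAt (fun x : ℝ => (x:ℂ) ^ (s-1)) x :=
      continuousAt_ofReal_cpow_const _ _ (Or.inr (ne_of_gt hx))
    fun_prop
  · filter_upwards [ae_restrict_mem measurableSet_Ioi] with x hx
    have hx : 0 < x := hx
    have h1 := cterm_bound w x (by rw [← ofReal_pow, ofReal_re, norm_real, Real.norm_eq_abs, sq_abs]; nlinarith) 0
    rw [phi_cterm] at h1
    simp only [Nat.cast_zero, zero_add, one_mul, norm_real, Real.norm_eq_abs, sq_abs] at h1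
    rw [norm_smul, norm_cpow_eq_rpow_re_of_pos hx]
    have := mul_le_mul_of_nonneg_left h1 (Real.rpow_nonneg hx.le (s.re - 1))
    simp only [sub_re, one_re, neg_mul, one_mul]
    linarith

lemma TH_mellin (s w : ℂ) (hs : 1 < s.re) :
    mellin (fun x : ℝ => TH w x - 1) s = completedRiemannZeta s * oneF1 (s/2) (1/2) (w^2/4) := by
  have hs0 : 0 < s.re := by linarith
  let G : ℕ → ℝ → ℂ := fun n x => (x:ℂ) ^ (s-1) * (2 * phi w (((n:ℝ)+1) * x))
  have hn : ∀ n : ℕ, (0:ℝ) < (n:ℝ) + 1 := fun n => by positivity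
  have hGint : ∀ n, IntegrableOn (G n) (Ioi 0) := by
    intro n
    have h := (MellinConvergent.comp_mul_left (hn n)).2 (phi_conv s w hs0)
    have := Integrable.const_mul h 2
    refine this.congr (Eventually.of_forall fun x => ?_)
    simp only [G, smul_eq_mul]; ring
  have hval : ∀ n : ℕ, ∫ x in Ioi (0:ℝ), G n x = 1 / ((n:ℂ)+1) ^ s * (2 * mellin (phi w) s) := by
    intro n
    have h := mellin_comp_mul_left (phi w) s (hn n)
    unfold mellin at h
    have e : ∀ x, G n x = 2 * ((x:ℂ) ^ (s-1) • phi w (((n:ℝ)+1) * x)) := by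
      intro x; simp only [G, smul_eq_mul]; ring
    simp_rw [e]
    rw [integral_const_mul, h, cpow_neg, mellin, smul_eq_mul]
    push_cast
    ring
  have hsumz : Summable (fun n : ℕ => 1 / ((n:ℂ)+1) ^ (s.re : ℂ)) := by
    have h := (summable_nat_add_iff 1).2 (Complex.summable_one_div_nat_cpow (p := (s.re : ℂ)).2 (by simpa using hs))
    simpa using h
  have hsum : Summable (fun n => ∫ x in Ioi (0:ℝ), ‖G n x‖) := by
    let psi : ℝ → ℂ := fun x => (‖phi w x‖ : ℂ)
    have h1 : Summable (fun n : ℕ => ‖1 / ((n:ℂ)+1) ^ (s.re:ℂ) * (2 * mellin psi s.re)‖) :=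
      (hsumz.mul_right _).norm
    convert h1 using 2 with n
    have h := mellin_comp_mul_left psi s.re (hn n)
    have e : ∀ x ∈ Ioi (0:ℝ), (‖G n x‖ : ℂ) = 2 * ((x:ℂ) ^ ((s.re:ℂ)-1) • psi (((n:ℝ)+1) * x)) := by
      intro x hx
      have hx : 0 < x := hx
      simp only [G, smul_eq_mul, psi]
      rw [norm_mul, norm_mul, norm_cpow_eq_rpow_re_of_pos hx, Complex.norm_ofNat]
      push_cast
      rw [ofReal_cpow hx.le]
      push_cast
      simp
      ring
    have h2 : ((∫ x in Ioi (0:ℝ), ‖G n x‖ : ℝ) : ℂ) = 1 / ((n:ℂ)+1) ^ (s.re:ℂ) * (2 * mellin psi s.re) := by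
      rw [← integral_complex_ofReal, setIntegral_congr_fun measurableSet_Ioi e, integral_const_mul]
      unfold mellin at h ⊢
      rw [h, cpow_neg, smul_eq_mul]
      push_cast
      ring
    rw [← h2, norm_real, Real.norm_of_nonneg (integral_nonneg (fun x => norm_nonneg _))]
  have h := hasSum_integral_of_summable_integral_norm hGint hsum
  simp_rw [hval] at h
  have h3 : mellin (fun x : ℝ => TH w x - 1) s = ∫ x in Ioi (0:ℝ), ∑' n, G n x := by
    unfold mellin
    refine setIntegral_congr_fun measurableSet_Ioi fun x hx => ?_
    have hx : 0 < x := hx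
    simp only [G]
    rw [tsum_mul_left, smul_eq_mul]
    congr 1
    have := (TH_hasSum w x (by rw [← ofReal_pow, ofReal_re]; positivity)).tsum_eq
    rw [← this]
    simp_rw [phi_cterm]
  rw [h3, ← h.tsum_eq, tsum_mul_right, ← zeta_eq_tsum_one_div_nat_add_one_cpow hs, phi_mellin s w hs0]
  have hs1 : s ≠ 0 := by rintro rfl; simp at hs0
  have hG := Gammaℝ_ne_zero_of_re_pos hs0
  rw [riemannZeta_def_of_ne_zero hs1]
  rw [Gammaℝ_def] at hG ⊢
  have := right_ne_zero_of_mul hG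
  field_simp

lemma TH_cont (w : ℂ) (x : ℝ) (hx : 0 < x) : ContinuousAt (fun x : ℝ => TH w x) x := by
  have h := (TH_differentiableAt w x (by rw [← ofReal_pow, ofReal_re]; positivity)).continuousAt
  exact ContinuousAt.comp (g := TH w) h continuous_ofReal.continuousAt

lemma TH_locInt (w : ℂ) : LocallyIntegrableOn (fun x : ℝ => TH w x) (Ioi 0) := by
  refine ContinuousOn.locallyIntegrableOn ?_ measurableSet_Ioi
  exact fun x hx => (TH_cont w x hx).continuousWithinAt

lemma TH_top (w : ℂ) (r : ℝ) : (fun x : ℝ => TH w x - 1) =O[atTop] (fun x : ℝ => x ^ r) := by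
  have h1 : (fun x : ℝ => TH w x - 1) =O[atTop] (fun x : ℝ => Real.exp (-(1/2) * x)) := by
    refine Asymptotics.IsBigO.of_bound (Bw w) ?_
    filter_upwards [eventually_ge_atTop 1] with x hx
    have hx0 : (x:ℂ) ≠ 0 := by
      have : x ≠ 0 := by linarith
      exact_mod_cast this
    have h := TH_bound w x hx0 (by rw [← ofReal_pow, ofReal_re, norm_real, Real.norm_eq_abs, sq_abs]; nlinarith)
    rw [norm_real, Real.norm_eq_abs, sq_abs, mul_div_assoc] at h
    refine h.trans (mul_le_mul_of_nonneg_left ?_ (Bw_nonneg w))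
    rw [Real.norm_of_nonneg (Real.exp_pos _).le]
    refine (div_le_self (Real.exp_pos _).le (by nlinarith)).trans ?_
    apply Real.exp_le_exp.2
    nlinarith
  exact h1.trans (isLittleO_exp_neg_mul_rpow_atTop (by norm_num) r).isBigO

def PP (w : ℂ) : WeakFEPair ℂ where
  f := fun x => TH w x
  g := fun x => TH (-I * w) x
  k := 1
  ε := Complex.exp (w ^ 2 / 4)
  f₀ := 1
  g₀ := 1
  hf_int := TH_locInt w
  hg_int := TH_locInt _
  hk := one_pos
  hε := Complex.exp_ne_zero _
  h_feq := by
    intro x hx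
    have := TH_feq w x hx
    rw [this, smul_eq_mul, Real.rpow_one]; ring
  hf_top := TH_top w
  hg_top := TH_top _

lemma PP_Λ (w s : ℂ) (h0 : s ≠ 0) (h1 : s ≠ 1) :
    (PP w).Λ s = completedRiemannZeta s * oneF1 (s/2) (1/2) (w^2/4) := by
  set U : Set ℂ := {0, 1}ᶜ with hU
  have hUo : IsOpen U := (Set.toFinite {0,1}).isClosed.isOpen_compl
  have hUc : IsPreconnected U := by
    have := (Set.toFinite ({0, 1} : Set ℂ)).countable.isConnected_compl_of_one_lt_rank
      (by rw [Complex.rank_real_complex]; exact Cardinal.one_lt_two)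
    exact this.isPreconnected
  have hf : AnalyticOnNhd ℂ (PP w).Λ U := by
    apply DifferentiableOn.analyticOnNhd _ hUo
    intro z hz
    simp [hU] at hz
    exact ((PP w).differentiableAt_Λ (Or.inl hz.1) (Or.inl (by simpa [PP] using hz.2))).differentiableWithinAt
  have hg : AnalyticOnNhd ℂ (fun s => completedRiemannZeta s * oneF1 (s/2) (1/2) (w^2/4)) U := by
    apply DifferentiableOn.analyticOnNhd _ hUo
    intro z hz
    simp [hU] at hz
    exact ((differentiableAt_completedZeta hz.1 hz.2).mul (oneF1_diff w z)).differentiableWithinAt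
  have h2 : (2:ℂ) ∈ U := by simp [hU]
  refine hf.eqOn_of_preconnected_of_eventuallyEq hg hUc h2 ?_ (by simp [hU, h0, h1])
  have : {z : ℂ | 1 < z.re} ∈ 𝓝 (2:ℂ) := (isOpen_lt continuous_const continuous_re).mem_nhds (by simp)
  filter_upwards [this] with z hz
  have h := ((PP w).hasMellin (s := z) (by simpa [PP] using hz)).2
  rw [← h]
  exact TH_mellin z w hz

def KK (w : ℂ) (x : ℝ) : ℂ := TH w x - 1 - Complex.exp (w ^ 2 / 4) * (x:ℂ)⁻¹

lemma KK_mellin (w s : ℂ) (h0 : 0 < s.re) (h1 : s.re < 1) :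
    HasMellin (KK w) s ((PP w).Λ s) := by
  have hm : HasMellin (PP w).f_modif s ((PP w).Λ₀ s) := by
    have h := (PP w).isStrongFEPair_toStrongFEPair.hasMellin s
    exact ⟨h.1, rfl⟩
  have hA : HasMellin (indicator (Ioc 0 1) (fun _ => 1 : ℝ → ℂ)) s (1 / s) := hasMellin_one_Ioc h0
  have hBf : ∀ x : ℝ, (x:ℂ) ^ (s-1) • indicator (Ioi (1:ℝ)) (fun x : ℝ => (x:ℂ)⁻¹) x
      = indicator (Ioi (1:ℝ)) (fun x : ℝ => (x:ℂ) ^ (s - 2)) x := by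
    intro x
    by_cases hx : x ∈ Ioi (1:ℝ)
    · rw [indicator_of_mem hx, indicator_of_mem hx, smul_eq_mul]
      have : (x:ℂ) ≠ 0 := by
        have h : (1:ℝ) < x := hx
        have : x ≠ 0 := by linarith
        exact_mod_cast this
      rw [← cpow_neg_one, ← cpow_add _ _ this]; congr 1; ring
    · rw [indicator_of_notMem hx, indicator_of_notMem hx, smul_zero]
  have hre : (s - 2).re < -1 := by simp; linarith
  have hsub : Ioi (1:ℝ) ∩ Ioi 0 = Ioi 1 := by
    apply inter_eq_left.2; exact Ioi_subset_Ioi zero_le_one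
  have hB : HasMellin (indicator (Ioi 1) (fun x : ℝ => (x:ℂ)⁻¹)) s (1 / (1 - s)) := by
    constructor
    · unfold MellinConvergent
      simp_rw [hBf]
      rw [IntegrableOn, integrable_indicator_iff measurableSet_Ioi, IntegrableOn, Measure.restrict_restrict measurableSet_Ioi, hsub]
      exact integrableOn_Ioi_cpow_of_lt hre one_pos
    · unfold mellin
      simp_rw [hBf]
      rw [integral_indicator measurableSet_Ioi, Measure.restrict_restrict measurableSet_Ioi, hsub,
        integral_Ioi_cpow_of_lt hre one_pos, ofReal_one, one_cpow, show s - 2 + 1 = -(1 - s) by ring, neg_div_neg_eq]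
  have hB' : HasMellin (fun x => Complex.exp (w^2/4) * indicator (Ioi 1) (fun x : ℝ => (x:ℂ)⁻¹) x) s
      (Complex.exp (w^2/4) * (1 / (1 - s))) := by
    have h1 := hB.1.const_smul (Complex.exp (w^2/4))
    refine ⟨h1, ?_⟩
    have := mellin_const_smul (indicator (Ioi 1) (fun x : ℝ => (x:ℂ)⁻¹)) s (Complex.exp (w^2/4))
    rw [hB.2] at this
    exact this
  have h12 := hasMellin_sub hm.1 hA.1
  have h123 := hasMellin_sub h12.1 hB'.1
  have hval := h123.2
  have hconv := h123.1
  rw [h12.2, hm.2, hA.2, hB'.2] at hval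
  have hae : ∀ᵐ x : ℝ ∂(volume.restrict (Ioi (0:ℝ))), (x:ℂ) ^ (s-1) •
      ((PP w).f_modif x - indicator (Ioc 0 1) (fun _ => 1 : ℝ → ℂ) x -
        Complex.exp (w^2/4) * indicator (Ioi 1) (fun x : ℝ => (x:ℂ)⁻¹) x) = (x:ℂ) ^ (s-1) • KK w x := by
    have hne : ∀ᵐ x : ℝ ∂(volume.restrict (Ioi (0:ℝ))), x ≠ 1 :=
      ae_restrict_of_ae (Measure.ae_ne volume 1)
    filter_upwards [hne, ae_restrict_mem measurableSet_Ioi] with x hx1 hx0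
    have hx0 : 0 < x := hx0
    congr 1
    unfold WeakFEPair.f_modif KK
    rcases lt_or_gt_of_ne hx1 with h | h
    · have a1 : x ∉ Ioi (1:ℝ) := by simp [h.le]
      have a2 : x ∈ Ioo (0:ℝ) 1 := ⟨hx0, h⟩
      have a3 : x ∈ Ioc (0:ℝ) 1 := ⟨hx0, h.le⟩
      simp only [Pi.add_apply, indicator_of_notMem a1, indicator_of_mem a2, indicator_of_mem a3]
      simp only [PP, Real.rpow_neg_one, ofReal_inv, smul_eq_mul]
      ring
    · have a1 : x ∈ Ioi (1:ℝ) := h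
      have a2 : x ∉ Ioo (0:ℝ) 1 := by simp [h.le]
      have a3 : x ∉ Ioc (0:ℝ) 1 := by simp [h]
      simp only [Pi.add_apply, indicator_of_notMem a2, indicator_of_mem a1, indicator_of_notMem a3]
      simp only [PP]
      ring
  refine ⟨Integrable.congr hconv hae, ?_⟩
  have : mellin (KK w) s = mellin (fun x => (PP w).f_modif x - indicator (Ioc 0 1) (fun _ => 1 : ℝ → ℂ) x -
        Complex.exp (w^2/4) * indicator (Ioi 1) (fun x : ℝ => (x:ℂ)⁻¹) x) s :=
    integral_congr_ae (hae.mono fun x hx => hx.symm)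
  rw [this, hval, WeakFEPair.Λ]
  simp [PP]
  ring

lemma KK_hr (w : ℂ) (u : ℝ) :
    Real.exp (-(1/2 : ℝ) * u) • KK w (Real.exp (-u)) = Complex.exp (w ^ 2 / 4) * hr (-I * w) u := by
  rw [← hr_symm, hr, HH, KK, real_smul]
  push_cast
  have e1 : Complex.exp (-(1/2) * (u:ℂ)) = Complex.exp (-u/2) := by ring_nf
  have e2 : Complex.exp (-u:ℂ) = Complex.exp (-u/2) * Complex.exp (-u/2) := by rw [← Complex.exp_add]; ring_nf
  have e3 : Complex.exp (-(-u)/2:ℂ) = (Complex.exp (-u/2))⁻¹ := by rw [← Complex.exp_neg]; ring_nf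
  rw [e1, e3]
  have := Complex.exp_ne_zero (-u/2 : ℂ)
  rw [mul_sub, e2]
  field_simp

lemma KK_vert (w : ℂ) : VerticalIntegrable (mellin (KK w)) (1/2 : ℝ) := by
  unfold VerticalIntegrable
  have h := ((hr_fourier_int (-I * w)).const_mul (Complex.exp (w^2/4)))
  have h2 : Integrable (fun y : ℝ => Complex.exp (w^2/4) * 𝓕 (hr (-I * w)) (y / (2 * Real.pi))) :=
    h.comp_div (by positivity)
  refine h2.congr (Eventually.of_forall fun y => ?_)
  simp only
  rw [mellin_eq_fourier]
  have : (((1/2:ℝ):ℂ) + y * I).re = 1/2 := by simp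
  have him : (((1/2:ℝ):ℂ) + y * I).im = y := by simp
  rw [this, him]
  simp_rw [KK_hr]
  rw [Real.fourier_eq, Real.fourier_eq, ← integral_const_mul]
  congr 1
  ext v
  simp only [Circle.smul_def, smul_eq_mul]
  ring

lemma KK_inv (w : ℂ) (x : ℝ) (hx : 0 < x) : mellinInv (1/2 : ℝ) (mellin (KK w)) x = KK w x := by
  refine mellinInv_mellin_eq _ _ hx ?_ (KK_vert w) ?_
  · exact (KK_mellin w _ (by norm_num) (by norm_num)).1
  · unfold KK
    have h1 := TH_cont w x hx
    have h2 : ContinuousAt (fun x : ℝ => (x:ℂ)⁻¹) x :=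
      ContinuousAt.inv₀ (by fun_prop) (by exact_mod_cast hx.ne')
    fun_prop

lemma XiLam (t : ℝ) : RiemannBigXi (t / 2) / (1 + (t:ℂ) ^ 2)
    = -(1/8) * completedRiemannZeta ((1 + I * t) / 2) := by
  have hs : (1:ℂ) / 2 + I * (t / 2) = (1 + I * t) / 2 := by ring
  have hre : ((1 + I * t) / 2 : ℂ).re = 1/2 := by
    rw [← hs]; simp
  have h0 : ((1 + I * t) / 2 : ℂ) ≠ 0 := by
    intro h; rw [h] at hre; norm_num at hre
  have hG := Gammaℝ_ne_zero_of_re_pos (s := (1 + I * t) / 2) (by rw [hre]; norm_num)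
  unfold RiemannBigXi RiemannXi
  rw [hs, riemannZeta_def_of_ne_zero h0]
  have hG2 := Gammaℝ_def ((1 + I * t) / 2)
  rw [mul_assoc ((1/2:ℂ) * _ * _), ← hG2, mul_assoc ((1/2:ℂ) * _ * _), mul_div_cancel₀ _ hG]
  have hne : (1 + (t:ℂ)^2) ≠ 0 := by
    have : (1 + t^2 : ℝ) ≠ 0 := by positivity
    exact_mod_cast this
  rw [div_eq_iff hne]
  linear_combination (1/8) * completedRiemannZeta ((1 + I * t) / 2) * t^2 * I_sq

def vertF (w : ℂ) (β : ℝ) (y : ℝ) : ℂ :=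
  (β:ℂ) ^ (-(((1/2:ℝ):ℂ) + y * I)) • mellin (KK w) (((1/2:ℝ):ℂ) + y * I)

lemma vertF_int (w : ℂ) (β : ℝ) (hβ : 0 < β) : Integrable (vertF w β) := by
  have h := KK_vert w
  unfold VerticalIntegrable at h
  refine Integrable.bdd_smul (𝕜 := ℂ) h (C := β ^ (-(1/2:ℝ))) ?_ ?_
  · refine Continuous.aestronglyMeasurable ?_
    have : (β:ℂ) ≠ 0 := by exact_mod_cast hβ.ne'
    exact Continuous.const_cpow (by fun_prop) (Or.inl this)
  · refine Eventually.of_forall fun y => ?_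
    rw [norm_cpow_eq_rpow_re_of_pos hβ]
    simp

lemma vertF_eq (w : ℂ) (α β : ℝ) (hα : 0 < α) (hβ : 0 < β) (hαβ : α * β = 1) (y : ℝ) (s : ℂ)
    (hs : s = 1/2 + y * I) :
    (Real.sqrt β : ℂ) * vertF w β y = (α:ℂ) ^ (s - 1/2) * (completedRiemannZeta s *
      oneF1 (s/2) (1/2) (w^2/4)) := by
  have hs' : ((1/2:ℝ):ℂ) + y * I = s := by rw [hs]; push_cast; ring
  have hre : s.re = 1/2 := by rw [hs]; simp
  have h0 : s ≠ 0 := by intro h; rw [h] at hre; norm_num at hre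
  have h1 : s ≠ 1 := by intro h; rw [h] at hre; norm_num at hre
  unfold vertF
  rw [hs', (KK_mellin w s (by rw [hre]; norm_num) (by rw [hre]; norm_num)).2, PP_Λ w s h0 h1,
    smul_eq_mul, ← mul_assoc]
  congr 1
  have hb : (β:ℂ) ≠ 0 := by exact_mod_cast hβ.ne'
  have hab : α = β⁻¹ := eq_inv_of_mul_eq_one_left hαβ
  rw [Real.sqrt_eq_rpow, ofReal_cpow hβ.le, ← cpow_add _ _ hb, hab, ofReal_inv,
    inv_cpow _ _ (by rw [arg_ofReal_of_nonneg hβ.le]; exact Real.pi_pos.ne), ← cpow_neg]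
  congr 1
  push_cast; ring

lemma int_half (F : ℝ → ℂ) (hF : Integrable F) :
    ∫ t in Ioi (0:ℝ), (F (t/2) + F (-t/2)) = 2 * ∫ y, F y := by
  have h2 : Integrable (fun t : ℝ => F (t/2)) := hF.comp_div two_ne_zero
  have h3 : Integrable (fun t : ℝ => F (-t/2)) := h2.comp_neg
  rw [integral_add h2.integrableOn h3.integrableOn]
  have := integral_comp_neg_Ioi 0 (fun t : ℝ => F (t/2))
  rw [this, neg_zero, add_comm, intervalIntegral.integral_Iic_add_Ioi h2.integrableOn h2.integrableOn,
    Measure.integral_comp_div F 2]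
  simp

lemma second (w : ℂ) (α β : ℝ) (hα : 0 < α) (hβ : 0 < β) (hαβ : α * β = 1) :
    (1 / (Real.pi : ℂ)) *
          ∫ t in Ioi (0:ℝ),
            RiemannBigXi (t / 2) / (1 + (t:ℂ) ^ 2) * nablaFun α w ((1 + I * t) / 2)
      = -(1/2) * Complex.exp (-w^2/8) * Real.sqrt β * KK w β := by
  have key : ∀ t : ℝ, RiemannBigXi (t / 2) / (1 + (t:ℂ) ^ 2) * nablaFun α w ((1 + I * t) / 2)
      = (-(1/8) * Complex.exp (-w^2/8) * Real.sqrt β) * (vertF w β (t/2) + vertF w β (-t/2)) := by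
    intro t
    have h1 := vertF_eq w α β hα hβ hαβ (t/2) ((1 + I * t)/2) (by push_cast; ring)
    have h2 := vertF_eq w α β hα hβ hαβ (-t/2) (1 - (1 + I * t)/2) (by push_cast; ring)
    rw [completedRiemannZeta_one_sub] at h2
    rw [XiLam, nablaFun, rhoFun, rhoFun, sub_sub_cancel]
    have e1 : (1:ℂ)/2 - (1 + I * t)/2 = 1 - (1 + I * t)/2 - 1/2 := by ring
    have e2 : (1:ℂ)/2 - (1 - (1 + I * t)/2) = (1 + I * t)/2 - 1/2 := by ring
    rw [e1, e2]
    linear_combination (1/8) * Complex.exp (-w^2/8) * h1 + (1/8) * Complex.exp (-w^2/8) * h2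
  simp_rw [key]
  rw [integral_const_mul, int_half _ (vertF_int w β hβ)]
  have hinv := KK_inv w β hβ
  unfold mellinInv at hinv
  rw [← hinv]
  change _ = _ * ((1 / (2 * Real.pi)) • ∫ y, vertF w β y)
  rw [real_smul]
  have : (Real.pi:ℂ) ≠ 0 := by exact_mod_cast Real.pi_ne_zero
  push_cast
  field_simp
  ring

/-- The general theta transformation formula and its `Ξ`-integral representation
(equation (1.5) of Dixit–Kumar; Theorem 1.2 of Dixit). -/
theorem general_theta_transformation (w : ℂ) (α β : ℝ) (hα : 0 < α) (hβ : 0 < β)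
    (hαβ : α * β = 1) :
    (Real.sqrt α : ℂ) * (Complex.exp (-w ^ 2 / 8) / (2 * α)
        - Complex.exp (w ^ 2 / 8) *
            ∑' n : ℕ+, Complex.exp (-Real.pi * (α:ℂ) ^ 2 * (n:ℂ) ^ 2) *
              Complex.cos ((Real.sqrt Real.pi : ℂ) * α * n * w))
      = (Real.sqrt β : ℂ) * (Complex.exp (w ^ 2 / 8) / (2 * β)
          - Complex.exp (-w ^ 2 / 8) *
              ∑' n : ℕ+, Complex.exp (-Real.pi * (β:ℂ) ^ 2 * (n:ℂ) ^ 2) *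
                Complex.cosh ((Real.sqrt Real.pi : ℂ) * β * n * w)) ∧
    (Real.sqrt β : ℂ) * (Complex.exp (w ^ 2 / 8) / (2 * β)
          - Complex.exp (-w ^ 2 / 8) *
              ∑' n : ℕ+, Complex.exp (-Real.pi * (β:ℂ) ^ 2 * (n:ℂ) ^ 2) *
                Complex.cosh ((Real.sqrt Real.pi : ℂ) * β * n * w))
      = (1 / (Real.pi : ℂ)) *
          ∫ t in Ioi (0:ℝ),
            RiemannBigXi (t / 2) / (1 + (t:ℂ) ^ 2) * nablaFun α w ((1 + I * t) / 2) := by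
  rw [second w α β hα hβ hαβ]
  have hsq : ∀ x : ℝ, 0 < x → 0 < ((x:ℂ)^2).re := by
    intro x hx
    rw [← ofReal_pow, ofReal_re]; positivity
  have hc : ∀ n : ℕ+, Complex.cos ((Real.sqrt Real.pi : ℂ) * α * n * w)
      = Complex.cosh ((Real.sqrt Real.pi : ℂ) * α * n * (-I * w)) := by
    intro n
    rw [← Complex.cosh_mul_I, ← Complex.cosh_neg]
    congr 1; ring
  simp_rw [hc]
  rw [TH_tsum (-I * w) α (hsq α hα), TH_tsum w β (hsq β hβ)]
  have hf := TH_feq w α hα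
  have hb : 1 / α = β := by rw [div_eq_iff hα.ne']; linarith
  rw [hb] at hf
  have hE : Complex.exp (w^2/4) = Complex.exp (w^2/8) * Complex.exp (w^2/8) := by
    rw [← Complex.exp_add]; ring_nf
  have hE2 : Complex.exp (-w^2/8) = (Complex.exp (w^2/8))⁻¹ := by
    rw [← Complex.exp_neg]; ring_nf
  have hE0 := Complex.exp_ne_zero (w^2/8)
  have ha0 : (Real.sqrt α : ℂ) ≠ 0 := by exact_mod_cast (Real.sqrt_pos.2 hα).ne'
  have hb0 : (β : ℂ) ≠ 0 := by exact_mod_cast hβ.ne'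
  constructor
  · have hsa : (α:ℂ) = (Real.sqrt α : ℂ) * Real.sqrt α := by
      exact_mod_cast (Real.mul_self_sqrt hα.le).symm
    have hbb : β = α⁻¹ := by rw [← hb, one_div]
    have hsb : (Real.sqrt β : ℂ) = (Real.sqrt α : ℂ)⁻¹ := by
      rw [hbb, Real.sqrt_inv, ofReal_inv]
    have hbc : (β:ℂ) = ((Real.sqrt α : ℂ) * Real.sqrt α)⁻¹ := by
      rw [← hsa, hbb, ofReal_inv]
    rw [hf, hsb, hE2, hE, hbc]
    generalize TH (-I * w) α = T
    rw [hsa]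
    field_simp
    ring
  · rw [KK, hE, hE2]
    field_simp
    ring
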